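/- Let K=K(c_1,c_2,c_1) be a symmetric A_3-crystal with symmetric extract B=(S, E_{1bar} disjoint-union E_{2bar}). Then B is isomorphic, as a 2-colored graph with color 1bar corresponding to 1tilde and color 2bar corresponding to 2tilde, to the worm graph W(c_1,c_2). -/

import Mathlib

open Classical

noncomputable section

/-- Iterate a partial operator `k` times. -/
def optIter {V : Type} (f : V → Option V) : ℕ → V → Option V
  | 0, v => some v
  | k + 1, v => (f v).bind (optIter f k)

/-- A vertex type together with, for every natural number (color) `i`,
a partial operator whose graph is the set of `i`-edges. -/
structure PreGraph where
  V : Type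
  F : ℕ → V → Option V

namespace PreGraph

/-- Partial inverse operator of color `i`. -/
def Finv (K : PreGraph) (i : ℕ) (v : K.V) : Option K.V :=
  if h : ∃ u, K.F i u = some v then some h.choose else none

/-- Number of edges of the maximal `i`-colored path beginning at `v`. -/
def h (K : PreGraph) (i : ℕ) (v : K.V) : ℕ :=
  sSup {k | (optIter (K.F i) k v).isSome = true}

/-- Number of edges of the maximal `i`-colored path ending at `v`. -/
def t (K : PreGraph) (i : ℕ) (v : K.V) : ℕ :=
  sSup {k | ∃ u, optIter (K.F i) k u = some v}

/-- One (undirected) step along an edge of any color. -/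
def Step (K : PreGraph) (u v : K.V) : Prop :=
  ∃ i, K.F i u = some v ∨ K.F i v = some u

/-- Weak connectivity. -/
def Connected (K : PreGraph) : Prop :=
  ∀ u v : K.V, Relation.ReflTransGen K.Step u v

/-- All edges have colors in `C`. -/
def ColorsIn (K : PreGraph) (C : Set ℕ) : Prop :=
  ∀ i ∉ C, ∀ v, K.F i v = none

end PreGraph

/-- `s` has no incoming edges. -/
def IsSource (K : PreGraph) (s : K.V) : Prop := ∀ i u, K.F i u ≠ some s

/-- `tv` has no outgoing edges. -/
def IsSink (K : PreGraph) (tv : K.V) : Prop := ∀ i, K.F i tv = none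

/-- `K` is a (finite) colored graph with colors in `C` satisfying axiom (A1):
every connected monochromatic subgraph is a finite directed path. -/
def IsColored (K : PreGraph) (C : Set ℕ) : Prop :=
  Finite K.V ∧ K.ColorsIn C ∧
  (∀ (i : ℕ) (u u' v : K.V), K.F i u = some v → K.F i u' = some v → u = u') ∧
  (∀ (i : ℕ) (v : K.V) (k : ℕ), 0 < k → optIter (K.F i) k v ≠ some v)

/-- `|i - j| = 1`. -/
def Neighb (i j : ℕ) : Prop := i + 1 = j ∨ j + 1 = i

/-- `|i - j| ≥ 2`. -/
def Far (i j : ℕ) : Prop := i + 2 ≤ j ∨ j + 2 ≤ i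

instance (i j : ℕ) : Decidable (Neighb i j) := by unfold Neighb; infer_instance
instance (i j : ℕ) : Decidable (Far i j) := by unfold Far; infer_instance

/-- Axiom (A2) for the ordered pair of distinct colors `(i, j)`. -/
def A2at (K : PreGraph) (i j : ℕ) : Prop :=
  (∀ u v, K.F i u = some v →
    K.t j v ≤ K.t j u ∧ K.h j u ≤ K.h j v ∧
    ((K.h j u : ℤ) - (K.t j u : ℤ)) - ((K.h j v : ℤ) - (K.t j v : ℤ)) =
      (if Neighb i j then (-1 : ℤ) else 0)) ∧
  (∀ u v w, K.F i u = some v → K.F i v = some w →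
    2 * K.h j v ≤ K.h j u + K.h j w)

/-- Axiom (A3) for neighboring colors `i, j`. -/
def A3at (K : PreGraph) (i j : ℕ) : Prop :=
  (∀ u v v', K.F i u = some v → K.F j u = some v' →
    K.h j v = K.h j u →
    ((K.h i v' : ℤ) - (K.h i u : ℤ) = 1 ∧ ∃ w, K.F j v = some w ∧ K.F i v' = some w)) ∧
  (∀ u u' v, K.F i u = some v → K.F j u' = some v →
    (K.h j v : ℤ) - (K.h j u : ℤ) = 1 →
    (K.h i v = K.h i u' ∧ ∃ w, K.F j w = some u ∧ K.F i w = some u'))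

/-- Axiom (A4) (Verma relations) for neighboring colors `i, j`. -/
def A4at (K : PreGraph) (i j : ℕ) : Prop :=
  (∀ u v v', K.F i u = some v → K.F j u = some v' →
    (K.h j v : ℤ) - (K.h j u : ℤ) = 1 → (K.h i v' : ℤ) - (K.h i u : ℤ) = 1 →
    ∃ w, (((K.F i u).bind (K.F j)).bind (K.F j)).bind (K.F i) = some w ∧
         (((K.F j u).bind (K.F i)).bind (K.F i)).bind (K.F j) = some w) ∧
  (∀ u u' v, K.F i u = some v → K.F j u' = some v →
    K.h j v = K.h j u → K.h i v = K.h i u' →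
    ∃ w, (((K.Finv i v).bind (K.Finv j)).bind (K.Finv j)).bind (K.Finv i) = some w ∧
         (((K.Finv j v).bind (K.Finv i)).bind (K.Finv i)).bind (K.Finv j) = some w)

/-- Axiom (A5) for colors `i, j` at distance at least 2. -/
def A5at (K : PreGraph) (i j : ℕ) : Prop :=
  ∀ Fi ∈ ({K.F i, K.Finv i} : Set (K.V → Option K.V)),
  ∀ Fj ∈ ({K.F j, K.Finv j} : Set (K.V → Option K.V)),
  ∀ v, (Fi v).isSome → (Fj v).isSome →
    ∃ w, (Fi v).bind Fj = some w ∧ (Fj v).bind Fi = some w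

/-- `K` is a regular crystal of type A on the color set `C`
(an `A_{|C|}`-crystal when `C` is an integer interval). -/
def IsCrystalOn (K : PreGraph) (C : Set ℕ) : Prop :=
  IsColored K C ∧ K.Connected ∧
  (∀ i ∈ C, ∀ j ∈ C, i ≠ j → A2at K i j) ∧
  (∀ i ∈ C, ∀ j ∈ C, Neighb i j → A3at K i j ∧ A4at K i j) ∧
  (∀ i ∈ C, ∀ j ∈ C, Far i j → A5at K i j)

/-- `K` is an `A_n`-crystal (colors `1, …, n`). -/
def IsACrystal (n : ℕ) (K : PreGraph) : Prop := IsCrystalOn K (Set.Icc 1 n)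

/-- Apply a list of operators, head first. -/
def applyStr (K : PreGraph) : List ℕ → K.V → Option K.V
  | [], v => some v
  | i :: L, v => (K.F i v).bind (applyStr K L)

/-- The string `w_{m,k,j} = F_{o+j} F_{o+j+1} ⋯ F_{o+j+k-1}` (rightmost applied
first, i.e. head of the list applied first) for a crystal with colors `o+1, …, o+m`. -/
def wStr (o k j : ℕ) : List ℕ := (List.range k).map (fun m => o + j + k - 1 - m)

/-- The string `S_{m,k} = w_{m,k,m-k+1} ⋯ w_{m,k,2} w_{m,k,1}` for a crystal with
colors `o+1, …, o+m`. -/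
def SStr (o m k : ℕ) : List ℕ :=
  (List.range (m - k + 1)).flatMap fun jm => wStr o k (jm + 1)

/-- The string `S_{m,m}^{a_{o+m}} ⋯ S_{m,1}^{a_{o+1}}` for a crystal with colors
`o+1, …, o+m`, defining the principal vertex with coordinates `a`. -/
def prinStr (o m : ℕ) (a : ℕ → ℕ) : List ℕ :=
  (List.range m).flatMap fun km => (List.replicate (a (o + km + 1)) (SStr o m (km + 1))).flatten

def prinOpt (K : PreGraph) (o m : ℕ) (s : K.V) (a : ℕ → ℕ) : Option K.V :=
  applyStr K (prinStr o m a) s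

/-- `p` is the principal vertex with coordinates `a` of the crystal `K` with colors
`o+1, …, o+m` and source `s`. -/
def IsPrin (K : PreGraph) (o m : ℕ) (s : K.V) (a : ℕ → ℕ) (p : K.V) : Prop :=
  prinOpt K o m s a = some p

/-- The principal lattice of an `A_n`-crystal with source `s` and parameter `c`. -/
def PrinLat (K : PreGraph) (n : ℕ) (s : K.V) (c : ℕ → ℕ) : Set K.V :=
  {p | ∃ a : ℕ → ℕ, (∀ i, 1 ≤ i → i ≤ n → a i ≤ c i) ∧ IsPrin K 0 n s a p}

/-- One undirected step along an edge with color in `I`. -/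
def stepOn (K : PreGraph) (I : Set ℕ) (u v : K.V) : Prop :=
  ∃ i ∈ I, K.F i u = some v ∨ K.F i v = some u

/-- `u` lies in the same `I`-colored component as `v`. -/
def inComp (K : PreGraph) (I : Set ℕ) (v u : K.V) : Prop :=
  Relation.ReflTransGen (stepOn K I) v u

/-- The subcrystal of `K` with color set `I` containing `v` (the maximal connected
subgraph through `v` using only colors in `I`). -/
def PreGraph.sub (K : PreGraph) (I : Set ℕ) (v : K.V) : PreGraph where
  V := {u : K.V // inComp K I v u}
  F := fun i u =>
    if hi : i ∈ I then
      (K.F i u.1).pbind fun w hw =>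
        some ⟨w, Relation.ReflTransGen.tail u.2 ⟨i, hi, Or.inl (Option.mem_def.mp hw)⟩⟩
    else none

/-- Directed reachability. -/
def dirReach (K : PreGraph) (u v : K.V) : Prop :=
  Relation.ReflTransGen (fun a b => ∃ i, K.F i a = some b) u v

/-- The interval of `K` from `p` to `q`: the subgraph formed by all vertices and
edges lying on directed paths from `p` to `q`. -/
def PreGraph.interval (K : PreGraph) (p q : K.V) : PreGraph where
  V := {w : K.V // dirReach K p w ∧ dirReach K w q}
  F := fun i u =>
    (K.F i u.1).pbind fun w _ =>
      if hw : dirReach K p w ∧ dirReach K w q then some ⟨w, hw⟩ else none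

/-- The symmetric extract: restriction to self-complementary vertices,
with `ibar`-edges given by `chain i`. -/
def extract (K : PreGraph) (chain : ℕ → K.V → Option K.V) (σ : K.V → K.V) : PreGraph where
  V := {v : K.V // σ v = v}
  F := fun i u =>
    (chain i u.1).pbind fun w _ => if hw : σ w = w then some ⟨w, hw⟩ else none

/-- The operator chain for the color `ibar` of the symmetric extract of a
symmetric `A_{2n-1}`-crystal. -/
def chainB (K : PreGraph) (n : ℕ) (i : ℕ) (u : K.V) : Option K.V :=
  if 1 ≤ i ∧ i ≤ n then
    (if i = n then K.F n u else (K.F i u).bind (K.F (2 * n - i)))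
  else none

/-- The operator chain for the color `ibar` of the symmetric extract of a
symmetric `A_{2n}`-crystal. -/
def chainC (K : PreGraph) (n : ℕ) (i : ℕ) (u : K.V) : Option K.V :=
  if 1 ≤ i ∧ i ≤ n then
    (if i = n then (((K.F n u).bind (K.F (n + 1))).bind (K.F (n + 1))).bind (K.F n)
     else (K.F i u).bind (K.F (2 * n + 1 - i)))
  else none

/-- Symmetric extract from a symmetric `A_{2n-1}`-crystal. -/
def extractB (K : PreGraph) (n : ℕ) (σ : K.V → K.V) : PreGraph := extract K (chainB K n) σ

/-- Symmetric extract from a symmetric `A_{2n}`-crystal. -/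
def extractC (K : PreGraph) (n : ℕ) (σ : K.V → K.V) : PreGraph := extract K (chainC K n) σ

/-- Admissibility of a six-tuple `(x', y, x''; y', x, y'')` in the worm model. -/
def WormOK (g1 g2 : ℕ) : ℤ × ℤ × ℤ × ℤ × ℤ × ℤ → Prop
  | (x', y, x'', y', x, y'') =>
    (0 ≤ x' ∧ x' ≤ 2 * (g1 : ℤ)) ∧ (0 ≤ x'' ∧ x'' ≤ 2 * (g1 : ℤ)) ∧
    (0 ≤ x ∧ x ≤ 2 * (g1 : ℤ)) ∧
    (0 ≤ y' ∧ y' ≤ (g2 : ℤ)) ∧ (0 ≤ y'' ∧ y'' ≤ (g2 : ℤ)) ∧ (0 ≤ y ∧ y ≤ (g2 : ℤ)) ∧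
    (2 ∣ x') ∧ (2 ∣ x'') ∧ (y' ≤ y ∧ y ≤ y'') ∧ (x' ≤ x ∧ x ≤ x'') ∧
    (y' < y → x' = x) ∧ (y < y'' → x = x'')

/-- The candidate image of a worm under the operator `1tilde`. -/
def worm1 : ℤ × ℤ × ℤ × ℤ × ℤ × ℤ → ℤ × ℤ × ℤ × ℤ × ℤ × ℤ
  | (x', y, x'', y', x, y'') =>
    if 2 * x > x' + x'' then (x' + 2, y, x'', y', x, y'')
    else if x = x' ∧ x' = x'' ∧ y < y'' then (x', y + 1, x'', y', x, y'')
    else (x', y, x'' + 2, y', x, y'')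

/-- The candidate image of a worm under the operator `2tilde`. -/
def worm2 : ℤ × ℤ × ℤ × ℤ × ℤ × ℤ → ℤ × ℤ × ℤ × ℤ × ℤ × ℤ
  | (x', y, x'', y', x, y'') =>
    if 2 * y > y' + y'' then (x', y, x'', y' + 1, x, y'')
    else if y' = y ∧ y = y'' ∧ x < x'' then (x', y, x'', y', x + 1, y'')
    else (x', y, x'', y', x, y'' + 1)

/-- The worm graph `W(g1, g2)`, with colors `1 = 1tilde` and `2 = 2tilde`. -/
def WormGraph (g1 g2 : ℕ) : PreGraph where
  V := {w : ℤ × ℤ × ℤ × ℤ × ℤ × ℤ // WormOK g1 g2 w}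
  F := fun i u =>
    if i = 1 then
      (if h1 : WormOK g1 g2 (worm1 u.1) then some ⟨worm1 u.1, h1⟩ else none)
    else if i = 2 then
      (if h2 : WormOK g1 g2 (worm2 u.1) then some ⟨worm2 u.1, h2⟩ else none)
    else none

/-- Isomorphism of colored graphs, renaming colors via `φ`. -/
def IsoVia (K L : PreGraph) (φ : ℕ → ℕ) : Prop :=
  ∃ e : K.V ≃ L.V, ∀ i u v, K.F i u = some v ↔ L.F (φ i) (e u) = some (e v)

/-- The Cartesian product of an `i`-path of length `p` and a `j`-path of length `q`. -/
def boxGraph (i j p q : ℕ) : PreGraph where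
  V := Fin (p + 1) × Fin (q + 1)
  F := fun s u =>
    if s = i then
      (if h : (u.1 : ℕ) < p then some (⟨(u.1 : ℕ) + 1, by omega⟩, u.2) else none)
    else if s = j then
      (if h : (u.2 : ℕ) < q then some (u.1, ⟨(u.2 : ℕ) + 1, by omega⟩) else none)
    else none

/-- `B_n`-crystal: components with colors `n-1, n` are worm graphs,
with color `n-1` corresponding to `1tilde` and `n` to `2tilde`. -/
def IsBCrystal (n : ℕ) (B : PreGraph) : Prop :=
  IsColored B (Set.Icc 1 n) ∧ B.Connected ∧
  (∀ i ∈ Set.Icc 1 n, ∀ j ∈ Set.Icc 1 n, Far i j → A5at B i j) ∧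
  (∀ i j, 1 ≤ i → i < n → 1 ≤ j → j < n → Neighb i j →
    ∀ v : B.V, IsCrystalOn (B.sub {i, j} v) {i, j}) ∧
  (∀ v : B.V, ∃ g1 g2 : ℕ,
    IsoVia (B.sub ({n - 1, n} : Set ℕ) v) (WormGraph g1 g2)
      (fun x => if x = n - 1 then 1 else if x = n then 2 else 0))

/-- `C_n`-crystal: components with colors `n-1, n` are worm graphs,
with color `n-1` corresponding to `2tilde` and `n` to `1tilde`. -/
def IsCCrystal (n : ℕ) (B : PreGraph) : Prop :=
  IsColored B (Set.Icc 1 n) ∧ B.Connected ∧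
  (∀ i ∈ Set.Icc 1 n, ∀ j ∈ Set.Icc 1 n, Far i j → A5at B i j) ∧
  (∀ i j, 1 ≤ i → i < n → 1 ≤ j → j < n → Neighb i j →
    ∀ v : B.V, IsCrystalOn (B.sub {i, j} v) {i, j}) ∧
  (∀ v : B.V, ∃ g1 g2 : ℕ,
    IsoVia (B.sub ({n - 1, n} : Set ℕ) v) (WormGraph g1 g2)
      (fun x => if x = n - 1 then 2 else if x = n then 1 else 0))

/-! ### The crossing model -/

/-- `(k, i, j)` is a node `v_i^k(j)` of the supporting graph `G` for rank `n`. -/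
def isNode (n k i j : ℕ) : Prop :=
  1 ≤ j ∧ j ≤ i ∧ i ≤ n ∧ i - j + 1 ≤ k ∧ k ≤ n - j + 1

instance (n k i j : ℕ) : Decidable (isNode n k i j) := by
  unfold isNode; infer_instance

/-- Extension of a function on the nodes of `G` to the extended supporting graph:
extra nodes from which `G^k` is reachable get value `c k`, the others get `0`. -/
def fext (n : ℕ) (c : ℕ → ℕ) (f : ℕ × ℕ × ℕ → ℤ) (k i j : ℕ) : ℤ :=
  if isNode n k i j then f (k, i, j)
  else if j ≤ n - k + 1 then (c k : ℤ) else 0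

/-- The slack at the node `v_i^k(j)`. -/
def epsN (n : ℕ) (c : ℕ → ℕ) (f : ℕ × ℕ × ℕ → ℤ) (k i j : ℕ) : ℤ :=
  (fext n c f k (i - 1) (j - 1) - fext n c f k i j) -
    (fext n c f k i (j - 1) - fext n c f k (i + 1) j)

/-- The total slack at the multinode `V_i(j)`. -/
def epsTot (n : ℕ) (c : ℕ → ℕ) (f : ℕ × ℕ × ℕ → ℤ) (i j : ℕ) : ℤ :=
  ∑ k ∈ Finset.Icc (i - j + 1) (n - j + 1), epsN n c f k i j

/-- The reduced slack at the multinode `V_i(j)`. -/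
def teps (n : ℕ) (c : ℕ → ℕ) (f : ℕ × ℕ × ℕ → ℤ) (i j : ℕ) : ℤ :=
  if hj : (Finset.Icc 1 j).Nonempty then
    max 0 ((Finset.Icc 1 j).inf' hj fun p => ∑ q ∈ Finset.Icc p j, epsTot n c f i q)
  else 0

/-- `k0` satisfies the switch condition in the multinode `V_i(j)`. -/
def switchCond (n : ℕ) (f : ℕ × ℕ × ℕ → ℤ) (i j k0 : ℕ) : Prop :=
  i - j + 1 ≤ k0 ∧ k0 ≤ n - j + 1 ∧
  (∀ k, i - j + 1 ≤ k → k < k0 → isNode n k (i + 1) (j + 1) →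
    f (k, i, j) = f (k, i + 1, j + 1)) ∧
  (∀ k, k0 < k → k ≤ n - j + 1 → isNode n k (i + 1) j →
    f (k, i + 1, j) = f (k, i, j))

/-- The switch-node (first node with the switch property) of the multinode `V_i(j)`. -/
def switchNode (n : ℕ) (f : ℕ × ℕ × ℕ → ℤ) (i j : ℕ) : ℕ :=
  sInf {k0 | switchCond n f i j k0}

/-- Feasible functions of the crossing model (normalized to vanish off the nodes). -/
def Feasible (n : ℕ) (c : ℕ → ℕ) (f : ℕ × ℕ × ℕ → ℤ) : Prop :=
  (∀ k i j, ¬ isNode n k i j → f (k, i, j) = 0) ∧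
  (∀ k i j, isNode n k i j → isNode n k (i - 1) j → f (k, i - 1, j) ≤ f (k, i, j)) ∧
  (∀ k i j, isNode n k i j → isNode n k (i + 1) (j + 1) → f (k, i + 1, j + 1) ≤ f (k, i, j)) ∧
  (∀ k i j, isNode n k i j → 0 ≤ f (k, i, j) ∧ f (k, i, j) ≤ (c k : ℤ)) ∧
  (∀ i j, 1 ≤ j → j ≤ i → i ≤ n → ∃ k0, switchCond n f i j k0)

/-- Increase `f` by one at the node `(k, i, j)`. -/
def bump (f : ℕ × ℕ × ℕ → ℤ) (k i j : ℕ) : ℕ × ℕ × ℕ → ℤ :=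
  fun x => if x = (k, i, j) then f x + 1 else f x

/-- The crossing-model graph `Kscr(c)`: vertices are the feasible functions, and
the move `φ_i` increases `f` by one at the switch-node of the active multinode. -/
def Kscr (n : ℕ) (c : ℕ → ℕ) : PreGraph where
  V := {f : ℕ × ℕ × ℕ → ℤ // Feasible n c f}
  F := fun i f =>
    if 1 ≤ i ∧ i ≤ n ∧ ∃ j, 1 ≤ j ∧ j ≤ i ∧ 0 < teps n c f.1 i j then
      (let j := sSup {j | 1 ≤ j ∧ j ≤ i ∧ 0 < teps n c f.1 i j}
       let g := bump f.1 (switchNode n f.1 i j) i j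
       if hg : Feasible n c g then some ⟨g, hg⟩ else none)
    else none

/-- The function `f_{a,D}` of the crossing model. -/
def faD (n : ℕ) (a : ℕ → ℕ) (D : ℕ → ℤ) : ℕ × ℕ × ℕ → ℤ := fun x =>
  if isNode n x.1 x.2.1 x.2.2 then
    (if x.2.1 - x.2.2 + 1 = x.1 then (a x.1 : ℤ) else (a x.1 : ℤ) + min (D (x.1 - 1)) 0) +
    (if x.2.2 ≤ n - x.1 then max (D x.1) 0 else 0)
  else 0

/-! ### Descriptions of self-complementary vertices -/

/-- `(a1, a2, δ, l)` is the description of a self-complementary vertex `v` of a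
symmetric `A_3`-crystal `K` with source `s` and parameter `c`. -/
def IsDescB (K : PreGraph) (s : K.V) (c : ℕ → ℕ) (v : K.V) (q : ℕ × ℕ × ℤ × ℕ) : Prop :=
  q.2.2.2 = K.t 2 v ∧
  ∃ (a : ℕ → ℕ) (pa : K.V),
    a 1 = q.1 ∧ a 2 = q.2.1 ∧ a 3 = ((q.1 : ℤ) + max q.2.2.1 0).toNat ∧
    (∀ i, 1 ≤ i → i ≤ 3 → a i ≤ c i) ∧
    IsPrin K 0 3 s a pa ∧ inComp K (Set.Icc 1 2) pa v ∧
    0 ≤ (q.2.1 : ℤ) + q.2.2.1 ∧ 0 ≤ (a 3 : ℤ) - q.2.2.1 ∧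
    ∃ s' : (K.sub (Set.Icc 1 2) pa).V, IsSource (K.sub (Set.Icc 1 2) pa) s' ∧
    ∃ z : (K.sub (Set.Icc 1 2) pa).V,
      IsPrin (K.sub (Set.Icc 1 2) pa) 0 2 s'
        (fun i => if i = 1 then ((q.2.1 : ℤ) + q.2.2.1).toNat else ((a 3 : ℤ) - q.2.2.1).toNat) z ∧
      inComp K ({2} : Set ℕ) z.1 v

/-- The polytope of descriptions for a symmetric `A_3`-crystal with parameter `(c1, c2, c1)`. -/
def QuadB (c1 c2 : ℕ) : Set (ℕ × ℕ × ℤ × ℕ) :=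
  {q | q.1 ≤ c1 ∧ q.2.1 ≤ c2 ∧ -(q.2.1 : ℤ) ≤ q.2.2.1 ∧ (q.2.1 : ℤ) - (c2 : ℤ) ≤ q.2.2.1 ∧
       q.2.2.1 ≤ (c1 : ℤ) - (q.1 : ℤ) ∧ (q.2.2.2 : ℤ) ≤ (c2 : ℤ) + 2 * q.2.2.1}

/-- The worm associated to the description `(a1, a2, δ, l)`. -/
def wtupleB (a1 a2 : ℕ) (δ : ℤ) (l : ℕ) : ℤ × ℤ × ℤ × ℤ × ℤ × ℤ :=
  let a3 : ℤ := (a1 : ℤ) + max δ 0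
  let tr : ℤ × ℤ × ℤ :=
    if 0 ≤ δ then
      if (l : ℤ) ≤ (a2 : ℤ) then ((l : ℤ), 2 * (a1 : ℤ), (a2 : ℤ))
      else if (l : ℤ) ≤ (a2 : ℤ) + 2 * δ then
        ((a2 : ℤ), 2 * (a1 : ℤ) + (l : ℤ) - (a2 : ℤ), (a2 : ℤ))
      else ((a2 : ℤ), 2 * a3, (l : ℤ) - 2 * δ)
    else
      if (l : ℤ) ≤ (a2 : ℤ) + δ then ((l : ℤ), 2 * (a1 : ℤ), (a2 : ℤ) - δ)
      else ((a2 : ℤ) + δ, 2 * (a1 : ℤ), (l : ℤ) - 2 * δ)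
  (2 * (a1 : ℤ), (a2 : ℤ), 2 * a3, tr.1, tr.2.1, tr.2.2)

def wtQ (q : ℕ × ℕ × ℤ × ℕ) : ℤ × ℤ × ℤ × ℤ × ℤ × ℤ :=
  wtupleB q.1 q.2.1 q.2.2.1 q.2.2.2

/-- The string `(F_2 F_3)^r (F_3 F_2)^r` (rightmost applied first). -/
def diagStr (r : ℕ) : List ℕ :=
  (List.replicate r ([2, 3] : List ℕ)).flatten ++ (List.replicate r ([3, 2] : List ℕ)).flatten

/-- `(a1, a2, δ, ρ)` is the description of a self-complementary vertex `v` of a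
symmetric `A_4`-crystal `K` with source `s` and parameter `c`. -/
def IsDescC (K : PreGraph) (s : K.V) (c : ℕ → ℕ) (v : K.V) (q : ℕ × ℕ × ℤ × ℕ) : Prop :=
  ∃ (a : ℕ → ℕ) (pa : K.V),
    a 1 = q.1 ∧ a 2 = q.2.1 ∧ a 3 = ((q.2.1 : ℤ) + min q.2.2.1 0).toNat ∧
    a 4 = ((q.1 : ℤ) + max q.2.2.1 0).toNat ∧
    (∀ i, 1 ≤ i → i ≤ 4 → a i ≤ c i) ∧
    IsPrin K 0 4 s a pa ∧ inComp K (Set.Icc 1 3) pa v ∧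
    0 ≤ (q.2.1 : ℤ) + q.2.2.1 ∧ 0 ≤ (a 4 : ℤ) - q.2.2.1 ∧
    (∃ s' : (K.sub (Set.Icc 1 3) pa).V, IsSource (K.sub (Set.Icc 1 3) pa) s' ∧
     ∃ z : (K.sub (Set.Icc 1 3) pa).V,
       IsPrin (K.sub (Set.Icc 1 3) pa) 0 3 s'
         (fun i => if i = 1 then ((q.2.1 : ℤ) + q.2.2.1).toNat
                   else if i = 2 then a 3 else ((a 4 : ℤ) - q.2.2.1).toNat) z ∧
       inComp K (Set.Icc 2 3) z.1 v) ∧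
    (∃ stil : (K.sub (Set.Icc 2 3) v).V, IsSource (K.sub (Set.Icc 2 3) v) stil ∧
       applyStr (K.sub (Set.Icc 2 3) v) (diagStr q.2.2.2) stil =
         some ⟨v, Relation.ReflTransGen.refl⟩)

/-- The polytope of descriptions for a symmetric `A_4`-crystal with parameter
`(c1, c2, c2, c1)`. -/
def QuadC (c1 c2 : ℕ) : Set (ℕ × ℕ × ℤ × ℕ) :=
  {q | q.1 ≤ c1 ∧ q.2.1 ≤ c2 ∧ -(q.2.1 : ℤ) ≤ q.2.2.1 ∧
       q.2.2.1 ≤ (c1 : ℤ) - (q.1 : ℤ) ∧ (q.2.2.2 : ℤ) ≤ (c2 : ℤ) + q.2.2.1}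

end

/-- The forward half of the local axioms of a crystal with colors `1, 2, 3`, for an edge relation
`Ed` and string lengths `h` (outgoing) and `t` (incoming). -/
structure HalfLocal {V : Type} (Ed : ℕ → V → V → Prop) (h t : ℕ → V → ℤ) : Prop where
  det : ∀ {i u v v'}, Ed i u v → Ed i u v' → v = v'
  col : ∀ {i u v}, Ed i u v → 1 ≤ i ∧ i ≤ 3
  nonneg : ∀ {i} u, 1 ≤ i → i ≤ 3 → 0 ≤ h i u
  pos_iff : ∀ {i} u, 1 ≤ i → i ≤ 3 → (0 < h i u ↔ ∃ v, Ed i u v)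
  step : ∀ {i u v}, Ed i u v → h i u = h i v + 1 ∧ t i v = t i u + 1
  near : ∀ {i j u v}, 1 ≤ j → j ≤ 3 → Neighb i j → Ed i u v →
    (h j v = h j u + 1 ∧ t j v = t j u) ∨ (h j v = h j u ∧ t j v = t j u - 1)
  far : ∀ {i j u v}, 1 ≤ j → j ≤ 3 → Far i j → Ed i u v → h j v = h j u ∧ t j v = t j u
  square : ∀ {i j u v v'}, Neighb i j → Ed i u v → Ed j u v' → h j v = h j u →
    h i v' = h i u + 1 ∧ ∃ w, Ed j v w ∧ Ed i v' w
  verma : ∀ {i j u v v'}, Neighb i j → Ed i u v → Ed j u v' →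
    h j v = h j u + 1 → h i v' = h i u + 1 →
    ∃ a b a' b' w, Ed j v a ∧ Ed j a b ∧ Ed i b w ∧ Ed i v' a' ∧ Ed i a' b' ∧ Ed j b' w
  comm : ∀ {i j u v v'}, Far i j → Ed i u v → Ed j u v' → ∃ w, Ed j v w ∧ Ed i v' w

/-- The lower three rows `x`, `(a, b)`, `(p, q, r)` of a Gelfand–Tsetlin pattern. -/
@[ext]
structure Pattern where
  (x a b p q r : ℤ)

namespace Pattern

/-- The interlacing conditions with top row `l`. -/
def Valid (l : ℤ × ℤ × ℤ × ℤ) (g : Pattern) : Prop :=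
  g.b ≤ g.x ∧ g.x ≤ g.a ∧ g.r ≤ g.b ∧ g.b ≤ g.q ∧ g.q ≤ g.a ∧ g.a ≤ g.p ∧
  l.2.2.2 ≤ g.r ∧ g.r ≤ l.2.2.1 ∧ l.2.2.1 ≤ g.q ∧ g.q ≤ l.2.1 ∧ l.2.1 ≤ g.p ∧ g.p ≤ l.1

/-- Length of the outgoing `i`-string. -/
def out (l : ℤ × ℤ × ℤ × ℤ) (i : ℕ) (g : Pattern) : ℤ :=
  if i = 1 then g.x - g.b
  else if i = 2 then g.b - g.r + max 0 (g.a + g.b - g.x - g.q)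
  else g.r - l.2.2.2 + max 0 (g.q - g.b - l.2.2.1 + g.r + max 0 (g.p - g.a - l.2.1 + g.q))

/-- Length of the incoming `i`-string. -/
def inc (l : ℤ × ℤ × ℤ × ℤ) (i : ℕ) (g : Pattern) : ℤ :=
  if i = 1 then g.a - g.x
  else if i = 2 then g.p - g.a + max 0 (g.x + g.q - g.a - g.b)
  else l.1 - g.p + max 0 (l.2.1 - g.q - g.p + g.a + max 0 (l.2.2.1 - g.r - g.q + g.b))

/-- The `i`-edges: one entry of the `i`-th row is decreased by one. -/
def Arrow (l : ℤ × ℤ × ℤ × ℤ) (i : ℕ) (g k : Pattern) : Prop :=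
  if i = 1 then g.b < g.x ∧ k = { g with x := g.x - 1 }
  else if i = 2 then
    (g.x + g.q < g.a + g.b ∧ k = { g with a := g.a - 1 }) ∨
    (g.a + g.b ≤ g.x + g.q ∧ g.r < g.b ∧ k = { g with b := g.b - 1 })
  else if i = 3 then
    (g.a + l.2.1 < g.p + g.q ∧ g.a + l.2.1 + g.b + l.2.2.1 < g.p + 2 * g.q + g.r ∧
      k = { g with p := g.p - 1 }) ∨
    (g.p + g.q ≤ g.a + l.2.1 ∧ g.b + l.2.2.1 < g.q + g.r ∧ k = { g with q := g.q - 1 }) ∨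
    (g.q + g.r ≤ g.b + l.2.2.1 ∧
      g.p + 2 * g.q + g.r ≤ g.a + l.2.1 + g.b + l.2.2.1 ∧
      l.2.2.2 < g.r ∧ k = { g with r := g.r - 1 })
  else False

variable {l : ℤ × ℤ × ℤ × ℤ}

theorem arrow_valid {i : ℕ} {g k : Pattern} (hg : g.Valid l) (e : Arrow l i g k) : k.Valid l := by
  unfold Arrow at e; unfold Valid at *
  split_ifs at e
  · rcases e with ⟨e, rfl⟩; grind
  · rcases e with ⟨e, rfl⟩ | ⟨e, _, rfl⟩ <;> grind
  · rcases e with ⟨e, _, rfl⟩ | ⟨e, _, rfl⟩ | ⟨e, _, _, rfl⟩ <;> grind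

theorem exists_arrow {i : ℕ} {g : Pattern} (hg : g.Valid l) (h1 : 1 ≤ i) (h3 : i ≤ 3) :
    0 < out l i g ↔ ∃ k, Arrow l i g k := by
  unfold Valid at hg
  unfold Arrow out
  interval_cases i <;> simp <;> grind

theorem arrow_near {i j : ℕ} {g k : Pattern} (e : Arrow l i g k) (hj : 1 ≤ j) (hj' : j ≤ 3)
    (n : Neighb i j) :
    (out l j k = out l j g + 1 ∧ inc l j k = inc l j g) ∨
      (out l j k = out l j g ∧ inc l j k = inc l j g - 1) := by
  unfold Arrow out inc Neighb at *
  interval_cases j <;> grind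

theorem arrow_step {i : ℕ} {g k : Pattern} (e : Arrow l i g k) :
    out l i g = out l i k + 1 ∧ inc l i k = inc l i g + 1 := by
  unfold Arrow out inc at *
  grind

theorem arrow_far {i j : ℕ} {g k : Pattern} (e : Arrow l i g k)
    (hj : 1 ≤ j) (hj' : j ≤ 3) (n : Far i j) :
    out l j k = out l j g ∧ inc l j k = inc l j g := by
  unfold Arrow out inc Far at *
  interval_cases j <;> grind

theorem arrow_col {i : ℕ} {g k : Pattern} (e : Arrow l i g k) : 1 ≤ i ∧ i ≤ 3 := by
  unfold Arrow at e; grind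

theorem arrow_det {i : ℕ} {g k k' : Pattern} (e : Arrow l i g k) (e' : Arrow l i g k') :
    k = k' := by
  unfold Arrow at e e'; grind

theorem neighb_cases {i j : ℕ} (hi : 1 ≤ i ∧ i ≤ 3) (hj : 1 ≤ j ∧ j ≤ 3) (n : Neighb i j) :
    (i = 1 ∧ j = 2) ∨ (i = 2 ∧ j = 1) ∨ (i = 2 ∧ j = 3) ∨ (i = 3 ∧ j = 2) := by
  unfold Neighb at n; omega

theorem square_eq {i j : ℕ} {g k k' w w' : Pattern} (hg : g.Valid l) (e : Arrow l i g k)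
    (e' : Arrow l j g k') (n : Neighb i j) (h : out l j k = out l j g)
    (f : Arrow l j k w) (f' : Arrow l i k' w') :
    w = w' := by
  unfold Valid at hg
  rcases neighb_cases (arrow_col e) (arrow_col e') n with
      ⟨rfl, rfl⟩ | ⟨rfl, rfl⟩ | ⟨rfl, rfl⟩ | ⟨rfl, rfl⟩ <;>
    simp [Arrow, out] at e e' h f f'
  · grind
  · grind
  · grind
  · grind

theorem square_label {i j : ℕ} {g k k' : Pattern} (e : Arrow l i g k)
    (e' : Arrow l j g k') (n : Neighb i j) (h : out l j k = out l j g) :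
    out l i k' = out l i g + 1 := by
  rcases neighb_cases (arrow_col e) (arrow_col e') n with
      ⟨rfl, rfl⟩ | ⟨rfl, rfl⟩ | ⟨rfl, rfl⟩ | ⟨rfl, rfl⟩ <;>
    simp [Arrow, out] at e e' h ⊢
  · grind
  · grind
  · grind
  · grind

theorem comm_eq {i j : ℕ} {g k k' w w' : Pattern} (e : Arrow l i g k) (e' : Arrow l j g k')
    (n : Far i j) (f : Arrow l j k w) (f' : Arrow l i k' w') : w = w' := by
  have hij : (i = 1 ∧ j = 3) ∨ (i = 3 ∧ j = 1) := by
    have := arrow_col e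
    have := arrow_col e'
    unfold Far at n
    omega
  rcases hij with ⟨rfl, rfl⟩ | ⟨rfl, rfl⟩ <;> simp [Arrow] at e e' f f' <;> grind

theorem verma_pos {i j : ℕ} {g k k' v w : Pattern} (hg : g.Valid l) (e : Arrow l i g k)
    (e' : Arrow l j g k') (n : Neighb i j) (h : out l j k = out l j g + 1)
    (h' : out l i k' = out l i g + 1)
    (f : Arrow l j k v) (f' : Arrow l j v w) :
    0 < out l i w := by
  unfold Valid at hg
  rcases neighb_cases (arrow_col e) (arrow_col e') n with
      ⟨rfl, rfl⟩ | ⟨rfl, rfl⟩ | ⟨rfl, rfl⟩ | ⟨rfl, rfl⟩ <;>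
    simp [Arrow, out] at e e' h h' f f' ⊢
  · grind
  · grind
  · grind
  · grind

theorem verma_eq {i j : ℕ} {g k k' v w v' w' y y' : Pattern} (hg : g.Valid l) (e : Arrow l i g k)
    (e' : Arrow l j g k') (n : i + 1 = j) (h : out l j k = out l j g + 1)
    (h' : out l i k' = out l i g + 1)
    (f : Arrow l j k v) (f' : Arrow l i k' v') (f₂ : Arrow l j v w) (f₂' : Arrow l i v' w')
    (f₃ : Arrow l i w y) (f₃' : Arrow l j w' y') : y = y' := by
  unfold Valid at hg
  rcases neighb_cases (arrow_col e) (arrow_col e') (Or.inl n) with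
      ⟨rfl, rfl⟩ | ⟨rfl, rfl⟩ | ⟨rfl, rfl⟩ | ⟨rfl, rfl⟩ <;> try omega
  · simp [Arrow, out] at e e' h h' f f' f₂ f₂' f₃ f₃'
    grind
  · simp [Arrow, out] at e e' h h' f f' f₂ f₂' f₃ f₃'
    rcases e with ⟨_, rfl⟩ | ⟨_, _, rfl⟩ <;>
      rcases e' with ⟨_, _, rfl⟩ | ⟨_, _, rfl⟩ | ⟨_, _, _, rfl⟩ <;>
      dsimp only at h h' f f' <;>
      first
      | (exfalso; omega)
      | (rcases f with ⟨_, _, rfl⟩ | ⟨_, _, rfl⟩ | ⟨_, _, _, rfl⟩ <;>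
          first
          | (exfalso; omega)
          | (rcases f' with ⟨_, rfl⟩ | ⟨_, _, rfl⟩ <;> first | (exfalso; omega) | grind))

end Pattern

theorem HalfLocal.transport {V V' : Type} {Ed : ℕ → V → V → Prop} {Ed' : ℕ → V' → V' → Prop}
    {h t : ℕ → V → ℤ} {h' t' : ℕ → V' → ℤ} (e : V ≃ V')
    (hEd : ∀ i u v, Ed i u v ↔ Ed' i (e u) (e v)) (hh : ∀ i u, h i u = h' i (e u))
    (ht : ∀ i u, t i u = t' i (e u)) (H : HalfLocal Ed' h' t') : HalfLocal Ed h t where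
  det a b := by
    rw [hEd] at a b
    exact e.injective (H.det a b)
  col a := H.col ((hEd _ _ _).1 a)
  nonneg u h1 h3 := by
    rw [hh]
    exact H.nonneg _ h1 h3
  pos_iff u h1 h3 := by
    rw [hh, H.pos_iff _ h1 h3, e.surjective.exists]
    simp only [hEd]
  step a := by
    simp only [hh, ht]
    exact H.step ((hEd _ _ _).1 a)
  near h1 h3 n a := by
    simp only [hh, ht]
    exact H.near h1 h3 n ((hEd _ _ _).1 a)
  far h1 h3 n a := by
    simp only [hh, ht]
    exact H.far h1 h3 n ((hEd _ _ _).1 a)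
  square n a b l := by
    simp only [hh, hEd] at a b l ⊢
    simpa only [e.surjective.exists] using H.square n a b l
  verma n a b l l' := by
    simp only [hh, hEd] at a b l l' ⊢
    simpa only [e.surjective.exists] using H.verma n a b l l'
  comm n a b := by
    simp only [hEd] at a b ⊢
    simpa only [e.surjective.exists] using H.comm n a b

namespace Pattern
variable {l : ℤ × ℤ × ℤ × ℤ}

theorem out_nonneg {g : Pattern} (i : ℕ) (hg : g.Valid l) : 0 ≤ out l i g := by
  unfold Valid out at *
  grind

/-- Patterns with top row `l`. -/
abbrev Of (l : ℤ × ℤ × ℤ × ℤ) : Type := {g : Pattern // g.Valid l}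

theorem halfLocal (l : ℤ × ℤ × ℤ × ℤ) :
    HalfLocal (V := Of l) (fun i u v => Arrow l i u.1 v.1) (fun i u => out l i u.1)
      (fun i u => inc l i u.1) where
  det a b := Subtype.ext (arrow_det a b)
  col a := arrow_col a
  nonneg u _ _ := out_nonneg _ u.2
  pos_iff u h1 h3 := by
    rw [exists_arrow u.2 h1 h3]
    exact ⟨fun ⟨k, e⟩ => ⟨⟨k, arrow_valid u.2 e⟩, e⟩, fun ⟨k, e⟩ => ⟨k.1, e⟩⟩
  step a := arrow_step a
  near h1 h3 n a := arrow_near a h1 h3 n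
  far h1 h3 n a := arrow_far a h1 h3 n
  square {i j u v v'} n a b lab := by
    have lab' := square_label a b n lab
    refine ⟨lab', ?_⟩
    have hu := out_nonneg i u.2
    have hb := (arrow_step b).1
    have hv := out_nonneg j v'.2
    obtain ⟨w, f⟩ := (exists_arrow v.2 (arrow_col b).1 (arrow_col b).2).1 (by omega)
    obtain ⟨w', f'⟩ :=
      (exists_arrow v'.2 (arrow_col a).1 (arrow_col a).2).1 (by omega)
    obtain rfl := square_eq u.2 a b n lab f f'
    exact ⟨⟨w, arrow_valid v.2 f⟩, f, f'⟩
  verma {i j u v v'} n a b lab lab' := by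
    have main : ∀ {i j : ℕ} {u v v' : Of l}, Neighb i j → Arrow l i u.1 v.1 → Arrow l j u.1 v'.1 →
        out l j v.1 = out l j u.1 + 1 → out l i v'.1 = out l i u.1 + 1 →
        ∃ x y z : Of l, Arrow l j v.1 x.1 ∧ Arrow l j x.1 y.1 ∧ Arrow l i y.1 z.1 := by
      intro i j u v v' n a b lab lab'
      have hb := (arrow_step b).1
      have hv := out_nonneg j v'.2
      obtain ⟨x, f⟩ :=
        (exists_arrow v.2 (arrow_col b).1 (arrow_col b).2).1 (by omega)
      have hx := arrow_valid v.2 f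
      have hf := (arrow_step f).1
      obtain ⟨y, f₂⟩ := (exists_arrow hx (arrow_col b).1 (arrow_col b).2).1 (by omega)
      have hy := arrow_valid hx f₂
      obtain ⟨z, f₃⟩ := (exists_arrow hy (arrow_col a).1 (arrow_col a).2).1
        (verma_pos u.2 a b n lab lab' f f₂)
      exact ⟨⟨x, hx⟩, ⟨y, hy⟩, ⟨z, arrow_valid hy f₃⟩, f, f₂, f₃⟩
    obtain ⟨x, y, z, f, f₂, f₃⟩ := main n a b lab lab'
    obtain ⟨x', y', z', f', f₂', f₃'⟩ := main n.symm b a lab' lab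
    have hz : z = z' := by
      refine Subtype.ext ?_
      rcases n with n | n
      · exact verma_eq u.2 a b n lab lab' f f' f₂ f₂' f₃ f₃'
      · exact (verma_eq u.2 b a n lab' lab f' f f₂' f₂ f₃' f₃).symm
    subst hz
    exact ⟨x, y, x', y', z, f, f₂, f₃, f', f₂', f₃'⟩
  comm {i j u v v'} n a b := by
    have ha := (arrow_far a (arrow_col b).1 (arrow_col b).2 n).1
    have hb := (arrow_far b (arrow_col a).1 (arrow_col a).2 n.symm).1
    have hv := out_nonneg i v.2
    have hv' := out_nonneg j v'.2
    have sa := (arrow_step a).1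
    have sb := (arrow_step b).1
    obtain ⟨w, f⟩ := (exists_arrow v.2 (arrow_col b).1 (arrow_col b).2).1 (by omega)
    obtain ⟨w', f'⟩ :=
      (exists_arrow v'.2 (arrow_col a).1 (arrow_col a).2).1 (by omega)
    obtain rfl := comm_eq a b n f f'
    exact ⟨⟨w, arrow_valid v.2 f⟩, f, f'⟩

/-- The negated and reversed pattern. -/
def dual (g : Pattern) : Pattern := ⟨-g.x, -g.b, -g.a, -g.r, -g.q, -g.p⟩

/-- The negated and reversed top row. -/
def dualTop (l : ℤ × ℤ × ℤ × ℤ) : ℤ × ℤ × ℤ × ℤ := (-l.2.2.2, -l.2.2.1, -l.2.1, -l.1)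

theorem dual_dual (g : Pattern) : g.dual.dual = g := by simp [dual]

theorem dualTop_dualTop (l : ℤ × ℤ × ℤ × ℤ) : dualTop (dualTop l) = l := by simp [dualTop]

theorem dual_valid {g : Pattern} (hg : g.Valid l) : g.dual.Valid (dualTop l) := by
  simp only [Valid, dual, dualTop] at *
  omega

theorem out_dual (i : ℕ) (g : Pattern) : out (dualTop l) i g.dual = inc l i g := by
  simp only [out, inc, dual, dualTop]
  grind

theorem inc_dual (i : ℕ) (g : Pattern) : inc (dualTop l) i g.dual = out l i g := by
  simp only [out, inc, dual, dualTop]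
  grind

theorem arrow_dual {i : ℕ} {g k : Pattern} (hg : g.Valid l) (e : Arrow l i g k) :
    Arrow (dualTop l) i k.dual g.dual := by
  simp only [Arrow, Valid, dual, dualTop] at *
  split_ifs at * <;> grind

/-- Duality of patterns. -/
def dualEquiv (l : ℤ × ℤ × ℤ × ℤ) : Of l ≃ Of (dualTop l) where
  toFun g := ⟨g.1.dual, dual_valid g.2⟩
  invFun g := ⟨g.1.dual, by simpa only [dualTop_dualTop] using dual_valid g.2⟩
  left_inv g := Subtype.ext (dual_dual _)
  right_inv g := Subtype.ext (dual_dual _)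

theorem halfLocal_flip (l : ℤ × ℤ × ℤ × ℤ) :
    HalfLocal (V := Of l) (fun i u v => Arrow l i v.1 u.1) (fun i u => inc l i u.1)
      (fun i u => out l i u.1) := by
  refine (halfLocal (dualTop l)).transport (dualEquiv l) (fun i u v => ⟨fun a => ?_, fun a => ?_⟩)
    (fun i u => (out_dual i u.1).symm) (fun i u => (inc_dual i u.1).symm)
  · exact arrow_dual v.2 a
  · have := arrow_dual (dual_valid u.2) a
    rwa [dualTop_dualTop, dualEquiv, Equiv.coe_fn_mk, dual_dual, dual_dual] at this

end Pattern

theorem optIter_add {V : Type} (f : V → Option V) (a b : ℕ) (v : V) :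
    optIter f (a + b) v = (optIter f a v).bind (optIter f b) := by
  induction a generalizing v with
  | zero => simp [optIter]
  | succ a ih =>
    rw [Nat.add_right_comm, optIter, optIter]
    cases f v with
    | none => rfl
    | some w => simp [ih]

theorem optIter_one {V : Type} (f : V → Option V) : optIter f 1 = f := by
  funext v
  simp only [optIter]
  cases f v <;> rfl

namespace PreGraph
variable {K : PreGraph} {C : Set ℕ}

theorem finite_h (hK : IsColored K C) (i : ℕ) (v : K.V) :
    {k | (optIter (K.F i) k v).isSome = true}.Finite := by
  obtain ⟨_, -, -, hc⟩ := hK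
  by_contra hinf
  have := Set.infinite_coe_iff.2 hinf
  obtain ⟨⟨a, ha⟩, ⟨b, hb⟩, hab, hne⟩ := Function.not_injective_iff.1
    (not_injective_infinite_finite fun k : {k | (optIter (K.F i) k v).isSome = true} =>
      (optIter (K.F i) k.1 v).get k.2)
  wlog hlt : a < b generalizing a b
  · exact this b hb a ha hab.symm hne.symm (by simp at hne; omega)
  obtain ⟨w, hw⟩ := Option.isSome_iff_exists.1 ha
  obtain ⟨w', hw'⟩ := Option.isSome_iff_exists.1 hb
  simp only [hw, hw', Option.get_some] at hab
  subst hab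
  refine hc i w (b - a) (by omega) ?_
  have := optIter_add (K.F i) a (b - a) v
  rwa [hw, Nat.add_sub_cancel' hlt.le, hw', Option.bind_some, eq_comm] at this

theorem finite_t (hK : IsColored K C) (i : ℕ) (v : K.V) :
    {k | ∃ u, optIter (K.F i) k u = some v}.Finite := by
  obtain ⟨_, -, -, hc⟩ := hK
  by_contra hinf
  have := Set.infinite_coe_iff.2 hinf
  obtain ⟨⟨a, ha⟩, ⟨b, hb⟩, hab, hne⟩ := Function.not_injective_iff.1
    (not_injective_infinite_finite fun k : {k | ∃ u, optIter (K.F i) k u = some v} => k.2.choose)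
  wlog hlt : a < b generalizing a b
  · exact this b hb a ha hab.symm hne.symm (by simp at hne; omega)
  have hw := ha.choose_spec
  have hw' := hb.choose_spec
  simp only at hab
  refine hc i v (b - a) (by omega) ?_
  have := optIter_add (K.F i) a (b - a) ha.choose
  rwa [hw, Nat.add_sub_cancel' hlt.le, hab, hw', Option.bind_some, eq_comm] at this

theorem h_of_none {i : ℕ} {u : K.V} (e : K.F i u = none) : K.h i u = 0 := by
  refine IsGreatest.csSup_eq ⟨by simp [optIter], ?_⟩
  rintro (_ | k) hk
  · exact le_rfl
  · simp [optIter, e] at hk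

theorem h_of_some (hK : IsColored K C) {i : ℕ} {u v : K.V} (e : K.F i u = some v) :
    K.h i u = K.h i v + 1 := by
  have hv : (optIter (K.F i) (K.h i v) v).isSome = true :=
    Nat.sSup_mem ⟨0, by simp [optIter]⟩ (finite_h hK i v).bddAbove
  refine IsGreatest.csSup_eq ⟨by simpa [optIter, e] using hv, ?_⟩
  rintro (_ | k) hk
  · exact Nat.zero_le _
  · exact Nat.succ_le_succ (le_csSup (finite_h hK i v).bddAbove (by simpa [optIter, e] using hk))

theorem t_of_none {i : ℕ} {v : K.V} (e : ∀ u, K.F i u ≠ some v) : K.t i v = 0 := by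
  refine IsGreatest.csSup_eq ⟨⟨v, by simp [optIter]⟩, ?_⟩
  rintro (_ | k) ⟨u, hu⟩
  · exact le_rfl
  · rw [optIter_add, Option.bind_eq_some_iff, optIter_one] at hu
    obtain ⟨w, -, hw⟩ := hu
    exact absurd hw (e w)

theorem t_of_some (hK : IsColored K C) {i : ℕ} {u v : K.V} (e : K.F i u = some v) :
    K.t i v = K.t i u + 1 := by
  have hu : ∃ w, optIter (K.F i) (K.t i u) w = some u :=
    Nat.sSup_mem (s := {k | ∃ w, optIter (K.F i) k w = some u}) ⟨0, u, by simp [optIter]⟩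
      (finite_t hK i u).bddAbove
  refine IsGreatest.csSup_eq ⟨?_, ?_⟩
  · obtain ⟨w, hw⟩ := hu
    exact ⟨w, by rw [optIter_add, optIter_one]; exact Option.bind_eq_some_iff.2 ⟨u, hw, e⟩⟩
  · rintro (_ | k) ⟨w, hw⟩
    · exact Nat.zero_le _
    · rw [optIter_add, Option.bind_eq_some_iff, optIter_one] at hw
      obtain ⟨u', hu', e'⟩ := hw
      obtain rfl := hK.2.2.1 i _ _ _ e e'
      exact Nat.succ_le_succ (le_csSup (finite_t hK i u).bddAbove ⟨w, hu'⟩)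

theorem Finv_eq_some_iff (hK : IsColored K C) {i : ℕ} {u v : K.V} :
    K.Finv i v = some u ↔ K.F i u = some v := by
  unfold Finv
  split_ifs with hu
  · rw [Option.some_inj]
    exact ⟨fun e => e ▸ hu.choose_spec, fun e => hK.2.2.1 i _ _ _ hu.choose_spec e⟩
  · exact ⟨fun e => by simp at e, fun e => absurd ⟨u, e⟩ hu⟩

theorem color_mem (hK : IsColored K C) {i : ℕ} {u v : K.V} (e : K.F i u = some v) : i ∈ C := by
  by_contra hi
  simp [hK.2.1 i hi] at e

theorem near (hK : IsACrystal 3 K) {i j : ℕ} {u v : K.V} (h1 : 1 ≤ j) (h3 : j ≤ 3)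
    (n : Neighb i j) (e : K.F i u = some v) :
    ((K.h j v : ℤ) = K.h j u + 1 ∧ (K.t j v : ℤ) = K.t j u) ∨
      ((K.h j v : ℤ) = K.h j u ∧ (K.t j v : ℤ) = K.t j u - 1) := by
  have hij : i ≠ j := by unfold Neighb at n; omega
  have := (hK.2.2.1 i (color_mem hK.1 e) j ⟨h1, h3⟩ hij).1 u v e
  rw [if_pos n] at this
  omega

theorem far (hK : IsACrystal 3 K) {i j : ℕ} {u v : K.V} (h1 : 1 ≤ j) (h3 : j ≤ 3)
    (n : Far i j) (e : K.F i u = some v) :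
    (K.h j v : ℤ) = K.h j u ∧ (K.t j v : ℤ) = K.t j u := by
  have hij : i ≠ j ∧ ¬ Neighb i j := by unfold Far at n; unfold Neighb; omega
  have := (hK.2.2.1 i (color_mem hK.1 e) j ⟨h1, h3⟩ hij.1).1 u v e
  rw [if_neg hij.2] at this
  omega

theorem halfLocal (hK : IsACrystal 3 K) :
    HalfLocal (fun i u v => K.F i u = some v) (fun i u => (K.h i u : ℤ))
      (fun i u => (K.t i u : ℤ)) where
  det a b := Option.some_inj.1 (a.symm.trans b)
  col a := color_mem hK.1 a
  nonneg _ _ _ := Int.natCast_nonneg _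
  pos_iff {i} u _ _ := by
    cases e : K.F i u with
    | none => simp [h_of_none e]
    | some v =>
      rw [h_of_some hK.1 e]
      exact iff_of_true (by positivity) ⟨v, rfl⟩
  step a := by
    rw [h_of_some hK.1 a, t_of_some hK.1 a]
    simp
  near := near hK
  far := far hK
  square {i j u v v'} n a b l := by
    obtain ⟨l', hw⟩ :=
      (hK.2.2.2.1 i (color_mem hK.1 a) j (color_mem hK.1 b) n).1.1 u v v' a b (by exact_mod_cast l)
    exact ⟨by omega, hw⟩
  verma {i j u v v'} n a b l l' := by
    obtain ⟨w, hw, hw'⟩ := (hK.2.2.2.1 i (color_mem hK.1 a) j (color_mem hK.1 b) n).2.1 u v v' a b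
      (by omega) (by omega)
    simp only [a, b, Option.bind_some, Option.bind_eq_some_iff] at hw hw'
    obtain ⟨y, ⟨x, hx, hy⟩, hz⟩ := hw
    obtain ⟨y', ⟨x', hx', hy'⟩, hz'⟩ := hw'
    exact ⟨x, y, x', y', w, hx, hy, hz, hx', hy', hz'⟩
  comm {i j u v v'} n a b := by
    obtain ⟨w, hw, hw'⟩ := hK.2.2.2.2 i (color_mem hK.1 a) j (color_mem hK.1 b) n
      (K.F i) (by simp) (K.F j) (by simp) u (by simp [a]) (by simp [b])
    exact ⟨w, by simpa [a] using hw, by simpa [b] using hw'⟩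

theorem halfLocal_flip (hK : IsACrystal 3 K) :
    HalfLocal (fun i u v => K.F i v = some u) (fun i u => (K.t i u : ℤ))
      (fun i u => (K.h i u : ℤ)) where
  det a b := hK.1.2.2.1 _ _ _ _ a b
  col a := color_mem hK.1 a
  nonneg _ _ _ := Int.natCast_nonneg _
  pos_iff {i} u _ _ := by
    by_cases e : ∃ v, K.F i v = some u
    · obtain ⟨v, e⟩ := e
      exact iff_of_true (by rw [t_of_some hK.1 e]; positivity) ⟨v, e⟩
    · rw [t_of_none (not_exists.1 e)]
      simp [e]
  step a := by
    rw [h_of_some hK.1 a, t_of_some hK.1 a]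
    simp
  near h1 h3 n a := by
    have := near hK h1 h3 n a
    omega
  far h1 h3 n a := by
    have := far hK h1 h3 n a
    omega
  square {i j u v v'} n a b l := by
    have ha := near hK (color_mem hK.1 b).1 (color_mem hK.1 b).2 n a
    have hb := near hK (color_mem hK.1 a).1 (color_mem hK.1 a).2 n.symm b
    obtain ⟨l', hw⟩ :=
      (hK.2.2.2.1 i (color_mem hK.1 a) j (color_mem hK.1 b) n).1.2 v v' u a b (by omega)
    exact ⟨by omega, hw⟩
  verma {i j u v v'} n a b l l' := by
    have ha := near hK (color_mem hK.1 b).1 (color_mem hK.1 b).2 n a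
    have hb := near hK (color_mem hK.1 a).1 (color_mem hK.1 a).2 n.symm b
    obtain ⟨w, hw, hw'⟩ := (hK.2.2.2.1 i (color_mem hK.1 a) j (color_mem hK.1 b) n).2.2 v v' u a b
      (by omega) (by omega)
    simp only [(Finv_eq_some_iff hK.1).2 a, (Finv_eq_some_iff hK.1).2 b, Option.bind_some,
      Option.bind_eq_some_iff, Finv_eq_some_iff hK.1] at hw hw'
    obtain ⟨y, ⟨x, hx, hy⟩, hz⟩ := hw
    obtain ⟨y', ⟨x', hx', hy'⟩, hz'⟩ := hw'
    exact ⟨x, y, x', y', w, hx, hy, hz, hx', hy', hz'⟩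
  comm {i j u v v'} n a b := by
    have a' := (Finv_eq_some_iff hK.1).2 a
    have b' := (Finv_eq_some_iff hK.1).2 b
    obtain ⟨w, hw, hw'⟩ := hK.2.2.2.2 i (color_mem hK.1 a) j (color_mem hK.1 b) n
      (K.Finv i) (by simp) (K.Finv j) (by simp) u (by simp [a']) (by simp [b'])
    exact ⟨w, by simpa [a', Finv_eq_some_iff hK.1] using hw,
      by simpa [b', Finv_eq_some_iff hK.1] using hw'⟩

end PreGraph

/-- Pairs of vertices of two edge-colored graphs reached from `s` and `s'` by the same word of
colors of length `n`. -/
inductive Matched {V W : Type} (E : ℕ → V → V → Prop) (E' : ℕ → W → W → Prop) (s : V) (s' : W) :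
    ℕ → V → W → Prop
  | base : Matched E E' s s' 0 s s'
  | step {n i u v m m'} : Matched E E' s s' n u m → E i u v → E' i m m' →
      Matched E E' s s' (n + 1) v m'

/-- Vertices matched at length `k` have matched predecessors. -/
def Lifts {V W : Type} (E : ℕ → V → V → Prop) (E' : ℕ → W → W → Prop) (s : V) (s' : W)
    (k : ℕ) : Prop :=
  ∀ ⦃i v m u⦄, Matched E E' s s' k v m → E i u v →
    ∃ n, k = n + 1 ∧ ∃ m₀, Matched E E' s s' n u m₀ ∧ E' i m₀ m

/-- Both halves of the local axioms, together with a source `s`. -/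
structure Local {V : Type} (E : ℕ → V → V → Prop) (h t : ℕ → V → ℤ) (s : V) : Prop where
  fwd : HalfLocal E h t
  bwd : HalfLocal (fun i u v => E i v u) t h
  source : ∀ i u, ¬ E i u s

section Comparison
variable {V W : Type} {E : ℕ → V → V → Prop} {E' : ℕ → W → W → Prop} {h t : ℕ → V → ℤ}
  {h' t' : ℕ → W → ℤ} {s : V} {s' : W}

theorem Matched.swap {k : ℕ} {v : V} {m : W} (r : Matched E E' s s' k v m) :
    Matched E' E s' s k m v := by
  induction r with
  | base => exact .base
  | step _ a b ih => exact ih.step b a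

theorem Local.inc_source (A : Local E h t s) {i : ℕ} (h1 : 1 ≤ i) (h3 : i ≤ 3) : t i s = 0 := by
  have := A.bwd.nonneg s h1 h3
  have := mt (A.bwd.pos_iff s h1 h3).1 (not_exists.2 (A.source i))
  omega

theorem color_cases (i j : ℕ) : i = j ∨ Neighb i j ∨ Far i j := by
  unfold Neighb Far
  omega

theorem Matched.weight (A : Local E h t s) (B : Local E' h' t' s')
    (hs : ∀ i, 1 ≤ i → i ≤ 3 → h i s = h' i s') {k : ℕ} {v : V} {m : W}
    (r : Matched E E' s s' k v m) {j : ℕ} (h1 : 1 ≤ j) (h3 : j ≤ 3) :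
    h j v - t j v = h' j m - t' j m := by
  induction r with
  | base => rw [hs j h1 h3, A.inc_source h1 h3, B.inc_source h1 h3]
  | @step n i u v m m' r a b ih =>
    rcases color_cases i j with rfl | n | n
    · have := A.fwd.step a
      have := B.fwd.step b
      omega
    · have := A.fwd.near h1 h3 n a
      have := B.fwd.near h1 h3 n b
      omega
    · have := A.fwd.far h1 h3 n a
      have := B.fwd.far h1 h3 n b
      omega

theorem Matched.inc_eq (A : Local E h t s) (B : Local E' h' t' s') {k : ℕ}
    (L : ∀ n ≤ k, Lifts E E' s s' n ∧ Lifts E' E s' s n) {v : V} {m : W}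
    (r : Matched E E' s s' k v m) {j : ℕ} (h1 : 1 ≤ j) (h3 : j ≤ 3) : t j v = t' j m := by
  induction k generalizing v m with
  | zero =>
    cases r
    rw [A.inc_source h1 h3, B.inc_source h1 h3]
  | succ k ih =>
    have hv := A.bwd.nonneg v h1 h3
    have hm := B.bwd.nonneg m h1 h3
    by_cases hp : 0 < t j v
    · obtain ⟨u, e⟩ := (A.bwd.pos_iff v h1 h3).1 hp
      obtain ⟨n, hn, m₀, r₀, e'⟩ := (L _ le_rfl).1 r e
      obtain rfl : k = n := by omega
      have := ih (fun n hn => L n (by omega)) r₀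
      have := (A.fwd.step e).2
      have := (B.fwd.step e').2
      omega
    · by_contra hne
      obtain ⟨m₀, e'⟩ := (B.bwd.pos_iff m h1 h3).1 (by omega)
      obtain ⟨n, hn, u, r₀, e⟩ := (L _ le_rfl).2 r.swap e'
      exact hp ((A.bwd.pos_iff v h1 h3).2 ⟨u, e⟩)

theorem Matched.out_eq (A : Local E h t s) (B : Local E' h' t' s')
    (hs : ∀ i, 1 ≤ i → i ≤ 3 → h i s = h' i s') {k : ℕ}
    (L : ∀ n ≤ k, Lifts E E' s s' n ∧ Lifts E' E s' s n) {v : V} {m : W}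
    (r : Matched E E' s s' k v m) {j : ℕ} (h1 : 1 ≤ j) (h3 : j ≤ 3) : h j v = h' j m := by
  have := r.inc_eq A B L h1 h3
  have := r.weight A B hs h1 h3
  omega

theorem Matched.exists_edge (A : Local E h t s) (B : Local E' h' t' s')
    (hs : ∀ i, 1 ≤ i → i ≤ 3 → h i s = h' i s') {k : ℕ}
    (L : ∀ n ≤ k, Lifts E E' s s' n ∧ Lifts E' E s' s n) {u v : V} {m : W}
    (r : Matched E E' s s' k u m) {j : ℕ} (e : E j u v) :
    ∃ m', E' j m m' ∧ Matched E E' s s' (k + 1) v m' := by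
  obtain ⟨h1, h3⟩ := A.fwd.col e
  obtain ⟨m', e'⟩ := (B.fwd.pos_iff m h1 h3).1
    ((r.out_eq A B hs L h1 h3) ▸ (A.fwd.pos_iff u h1 h3).2 ⟨v, e⟩)
  exact ⟨m', e', r.step e e'⟩

/-- In a local Verma configuration both edges leaving the top vertex have label one. -/
theorem Local.verma_label (A : Local E h t s) {i j : ℕ} {w b a u₀ b' a' u v : V} (n : Neighb i j)
    (e₁ : E i w b) (e₂ : E j b a) (e₃ : E j a u₀) (e₄ : E i u₀ v)
    (f₁ : E j w b') (f₂ : E i b' a') (f₃ : E i a' u) (f₄ : E j u v)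
    (lu : h i v = h i u) (lu₀ : h j v = h j u₀) : h j b = h j w + 1 := by
  have hj := A.fwd.col f₁
  rcases A.fwd.near hj.1 hj.2 n e₁ with hl | hl
  · exact hl.1
  exfalso
  obtain ⟨-, x, g₁, g₂⟩ := A.fwd.square n e₁ f₁ hl.1
  obtain rfl := A.fwd.det g₁ e₂
  obtain rfl := A.fwd.det g₂ f₂
  have s₃ := (A.fwd.step e₃).1
  have s₄ := (A.fwd.step e₄).1
  have r₃ := (A.fwd.step f₃).1
  have r₄ := (A.fwd.step f₄).1
  have := (A.fwd.square n f₃ e₃ (by omega)).1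
  omega

theorem lifts_step (A : Local E h t s) (B : Local E' h' t' s')
    (hs : ∀ i, 1 ≤ i → i ≤ 3 → h i s = h' i s') {k : ℕ}
    (L : ∀ n < k, Lifts E E' s s' n ∧ Lifts E' E s' s n) : Lifts E E' s s' k := by
  intro i v m u₀ r e₀
  cases r with
  | base => exact absurd e₀ (A.source i u₀)
  | @step n j u _ m₁ _ r e e' =>
    have hi := A.fwd.col e₀
    have hj := A.fwd.col e
    have out : ∀ {k' x y c}, k' < n + 1 → Matched E E' s s' k' x y → 1 ≤ c → c ≤ 3 →
        h c x = h' c y := fun hk r h1 h3 => r.out_eq A B hs (fun n hn => L n (by omega)) h1 h3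
    refine ⟨n, rfl, ?_⟩
    have diamond : ∀ {w}, E i w u → E j w u₀ →
        (∀ {m₂ m₃}, E' i m₂ m₁ → E' j m₂ m₃ → h' j m₁ = h j u → h' j m₂ = h j w →
          h' i m₂ = h i w → h' i m₃ = h i u₀ → ∃ z, E' j m₁ z ∧ E' i m₃ z) →
        ∃ m₀, Matched E E' s s' n u₀ m₀ ∧ E' i m₀ m := by
      intro w f f₀ H
      obtain ⟨n', rfl, m₂, r₂, g⟩ := (L n (by omega)).1 r f
      obtain ⟨m₃, g₀, r₃⟩ := r₂.exists_edge A B hs (fun n hn => L n (by omega)) f₀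
      obtain ⟨z, hz, hz'⟩ := H g g₀ (out (by omega) r hj.1 hj.2).symm
        (out (by omega) r₂ hj.1 hj.2).symm (out (by omega) r₂ hi.1 hi.2).symm
        (out (by omega) r₃ hi.1 hi.2).symm
      obtain rfl := B.fwd.det hz e'
      exact ⟨m₃, r₃, hz'⟩
    have se := (A.fwd.step e).1
    have se₀ := (A.fwd.step e₀).1
    rcases color_cases i j with rfl | nb | fr
    · obtain rfl := A.bwd.det e e₀
      exact ⟨m₁, r, e'⟩
    · have le := A.fwd.near hi.1 hi.2 nb.symm e
      have le₀ := A.fwd.near hj.1 hj.2 nb e₀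
      by_cases c : h i v = h i u + 1
      · obtain ⟨l, w, f, f₀⟩ := A.bwd.square nb.symm e e₀ (by omega)
        have sf := (A.fwd.step f).1
        have sf₀ := (A.fwd.step f₀).1
        exact diamond f f₀ fun g g₀ _ _ _ _ => (B.fwd.square nb g g₀ (by omega)).2
      by_cases c₀ : h j v = h j u₀ + 1
      · obtain ⟨l, w, f₀, f⟩ := A.bwd.square nb e₀ e (by omega)
        have sf := (A.fwd.step f).1
        have sf₀ := (A.fwd.step f₀).1
        exact diamond f f₀ fun g g₀ _ _ _ _ =>
          (B.fwd.square nb.symm g₀ g (by omega)).2.imp fun _ => And.symm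
      · obtain ⟨a, b, a', b', w, e₃, e₂, e₁, f₃, f₂, f₁⟩ :=
          A.bwd.verma nb e₀ e (by omega) (by omega)
        have lb := A.verma_label nb e₁ e₂ e₃ e₀ f₁ f₂ f₃ e (by omega) (by omega)
        have lb' := A.verma_label nb.symm f₁ f₂ f₃ e e₁ e₂ e₃ e₀ (by omega) (by omega)
        obtain ⟨_, rfl, ma', ra', g₃⟩ := (L n (by omega)).1 r f₃
        obtain ⟨_, rfl, mb', rb', g₂⟩ := (L _ (by omega)).1 ra' f₂
        obtain ⟨p, rfl, mw, rₘ, g₁⟩ := (L _ (by omega)).1 rb' f₁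
        obtain ⟨mb, q₁, rb⟩ := rₘ.exists_edge A B hs (fun n hn => L n (by omega)) e₁
        rw [out (by omega) rb hj.1 hj.2, out (by omega) rₘ hj.1 hj.2] at lb
        rw [out (by omega) rb' hi.1 hi.2, out (by omega) rₘ hi.1 hi.2] at lb'
        obtain ⟨x, y, x', y', z, q₂, q₃, q₄, p₂, p₃, p₄⟩ := B.fwd.verma nb q₁ g₁ lb lb'
        obtain rfl := B.fwd.det g₂ p₂
        obtain rfl := B.fwd.det g₃ p₃
        obtain rfl := B.fwd.det e' p₄
        exact ⟨y, (rb.step e₂ q₂).step e₃ q₃, q₄⟩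
    · obtain ⟨w, f₀, f⟩ := A.bwd.comm fr e₀ e
      exact diamond f f₀ fun g g₀ _ _ _ _ => B.fwd.comm fr g g₀

theorem lifts (A : Local E h t s) (B : Local E' h' t' s')
    (hs : ∀ i, 1 ≤ i → i ≤ 3 → h i s = h' i s') (k : ℕ) :
    Lifts E E' s s' k ∧ Lifts E' E s' s k := by
  induction k using Nat.strong_induction_on with
  | _ k ih =>
    exact ⟨lifts_step A B hs ih,
      lifts_step B A (fun i h1 h3 => (hs i h1 h3).symm) fun n hn => (ih n hn).symm⟩

theorem Matched.unique (A : Local E h t s) (B : Local E' h' t' s')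
    (hs : ∀ i, 1 ≤ i → i ≤ 3 → h i s = h' i s') {k k' : ℕ} {v : V} {m m' : W}
    (r : Matched E E' s s' k v m) (r' : Matched E E' s s' k' v m') : k = k' ∧ m = m' := by
  induction r generalizing k' m' with
  | base =>
    cases r' with
    | base => exact ⟨rfl, rfl⟩
    | step _ e _ => exact absurd e (A.source _ _)
  | step r e e' ih =>
    obtain ⟨n, rfl, m₀, r₀, e₀⟩ := (lifts A B hs k').1 r' e
    obtain ⟨rfl, rfl⟩ := ih r₀
    exact ⟨rfl, B.fwd.det e' e₀⟩

/-- A connected graph satisfying the local axioms embeds, as the component of the source, into any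
other graph satisfying them whose source has the same string lengths. -/
theorem Local.exists_embedding (A : Local E h t s) (B : Local E' h' t' s')
    (hs : ∀ i, 1 ≤ i → i ≤ 3 → h i s = h' i s')
    (conn : ∀ v, Relation.ReflTransGen (fun u v => ∃ i, E i u v ∨ E i v u) s v) :
    ∃ (e : V → W) (rk : V → ℕ), Function.Injective e ∧ e s = s' ∧
      (∀ i u v, E i u v ↔ E' i (e u) (e v)) ∧
      (∀ i u m, E' i (e u) m → ∃ v, E i u v ∧ e v = m) ∧
      (∀ i u v, E i u v → rk v = rk u + 1) ∧
      (∀ v, (∀ i u, ¬ E i u v) → v = s) := by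
  have L := lifts A B hs
  have total : ∀ v, ∃ (m : W) (k : ℕ), Matched E E' s s' k v m := by
    intro v
    induction conn v with
    | refl => exact ⟨s', 0, .base⟩
    | tail _ a ih =>
      obtain ⟨m, k, r⟩ := ih
      obtain ⟨i, a | a⟩ := a
      · obtain ⟨m', -, r'⟩ := r.exists_edge A B hs (fun n _ => L n) a
        exact ⟨m', _, r'⟩
      · obtain ⟨n, -, m₀, r₀, -⟩ := (L k).1 r a
        exact ⟨m₀, n, r₀⟩
  choose e rk he using total
  have inj : Function.Injective e := fun u v huv =>
    ((he u).swap.unique B A (fun i h1 h3 => (hs i h1 h3).symm) (huv ▸ (he v).swap)).2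
  have pull : ∀ i u m, E' i (e u) m → ∃ v, E i u v ∧ e v = m := by
    intro i u m a
    obtain ⟨v, b, r⟩ := (he u).swap.exists_edge B A (fun i h1 h3 => (hs i h1 h3).symm)
      (fun n _ => (L n).symm) a
    exact ⟨v, b, ((he v).unique A B hs r.swap).2⟩
  have push : ∀ i u v, E i u v → E' i (e u) (e v) ∧ rk v = rk u + 1 := by
    intro i u v a
    obtain ⟨m', b, r⟩ := (he u).exists_edge A B hs (fun n _ => L n) a
    obtain ⟨h₁, h₂⟩ := (he v).unique A B hs r
    exact ⟨h₂ ▸ b, h₁⟩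
  refine ⟨e, rk, inj, ((he s).unique A B hs .base).2, fun i u v => ⟨fun a => (push i u v a).1, ?_⟩,
    pull, fun i u v a => (push i u v a).2, fun v hv => ?_⟩
  · intro a
    obtain ⟨v', b, hv'⟩ := pull i u _ a
    exact inj hv' ▸ b
  · obtain ⟨k, m, r⟩ : ∃ k m, Matched E E' s s' k v m := ⟨_, _, he v⟩
    cases r with
    | base => rfl
    | step _ a _ => exact absurd a (hv _ _)

end Comparison

/-- The top row of the patterns forming the crystal with parameter `(g₁, g₂, g₁)`. -/
def symTop (g₁ g₂ : ℕ) : ℤ × ℤ × ℤ × ℤ := (2 * g₁ + g₂, g₁ + g₂, g₁, 0)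

/-- The pattern corresponding to a worm. -/
def wormPattern (g₁ g₂ : ℕ) : ℤ × ℤ × ℤ × ℤ × ℤ × ℤ → Pattern
  | (x', y, x'', y', x, y'') =>
    ⟨2 * g₁ + g₂ - x' / 2 - x'' / 2 - y, 2 * g₁ + g₂ - y' - min (x - x' / 2) (x'' / 2),
      g₁ + g₂ - y'' - max (x' / 2) (x - x'' / 2), 2 * g₁ + g₂ - x' / 2, g₁ + g₂ - y, g₁ - x'' / 2⟩

section Worm
variable {g₁ g₂ : ℕ} {w : ℤ × ℤ × ℤ × ℤ × ℤ × ℤ}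

theorem wormPattern_valid (hw : WormOK g₁ g₂ w) :
    (wormPattern g₁ g₂ w).Valid (symTop g₁ g₂) := by
  obtain ⟨X, y, Z, Y, x, T⟩ := w
  simp only [WormOK, wormPattern, Pattern.Valid, symTop] at *
  refine ⟨?_, ?_, ?_, ?_, ?_, ?_, ?_, ?_, ?_, ?_, ?_, ?_⟩ <;> omega

theorem wormPattern_injective {w w'} (hw : WormOK g₁ g₂ w) (hw' : WormOK g₁ g₂ w')
    (e : wormPattern g₁ g₂ w = wormPattern g₁ g₂ w') : w = w' := by
  obtain ⟨X, y, Z, Y, x, T⟩ := w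
  obtain ⟨X', y', Z', Y', x', T'⟩ := w'
  simp only [WormOK, wormPattern, Pattern.mk.injEq, Prod.mk.injEq] at *
  obtain rfl : X = X' := by omega
  obtain rfl : y = y' := by omega
  obtain rfl : Z = Z' := by omega
  refine ⟨rfl, rfl, rfl, ?_⟩
  omega

theorem arrow_worm2 (hw : WormOK g₁ g₂ w) (hw' : WormOK g₁ g₂ (worm2 w)) :
    Pattern.Arrow (symTop g₁ g₂) 2 (wormPattern g₁ g₂ w) (wormPattern g₁ g₂ (worm2 w)) := by
  obtain ⟨X, y, Z, Y, x, T⟩ := w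
  simp only [worm2] at *
  split_ifs at * <;> simp [WormOK, wormPattern, Pattern.Arrow] at * <;> omega

theorem wormOK_worm2 {k : Pattern} (hw : WormOK g₁ g₂ w)
    (e : Pattern.Arrow (symTop g₁ g₂) 2 (wormPattern g₁ g₂ w) k) : WormOK g₁ g₂ (worm2 w) := by
  obtain ⟨X, y, Z, Y, x, T⟩ := w
  simp only [worm2] at *
  split_ifs <;> simp [WormOK, wormPattern, Pattern.Arrow] at * <;> grind

theorem arrow_worm1 (hw : WormOK g₁ g₂ w) (hw' : WormOK g₁ g₂ (worm1 w)) :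
    ∃ g, Pattern.Arrow (symTop g₁ g₂) 1 (wormPattern g₁ g₂ w) g ∧
      Pattern.Arrow (symTop g₁ g₂) 3 g (wormPattern g₁ g₂ (worm1 w)) := by
  obtain ⟨X, y, Z, Y, x, T⟩ := w
  simp only [worm1] at *
  split_ifs at * <;> simp [WormOK, wormPattern, Pattern.Arrow, symTop] at * <;> omega

theorem wormOK_worm1 {g k : Pattern} (hw : WormOK g₁ g₂ w)
    (e : Pattern.Arrow (symTop g₁ g₂) 1 (wormPattern g₁ g₂ w) g)
    (e' : Pattern.Arrow (symTop g₁ g₂) 3 g k) : WormOK g₁ g₂ (worm1 w) := by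
  obtain ⟨X, y, Z, Y, x, T⟩ := w
  simp only [worm1] at *
  split_ifs <;> simp [WormOK, wormPattern, Pattern.Arrow, symTop] at * <;> grind

theorem exists_worm_pred (hw : WormOK g₁ g₂ w) (h0 : w ≠ (0, 0, 0, 0, 0, 0)) :
    ∃ w', WormOK g₁ g₂ w' ∧ (worm1 w' = w ∨ worm2 w' = w) := by
  obtain ⟨X, y, Z, Y, x, T⟩ := w
  simp only [WormOK, ne_eq, Prod.mk.injEq] at hw h0
  by_cases c₁ : 2 * y < Y + T
  · refine ⟨(X, y, Z, Y, x, T - 1), by simp only [WormOK]; omega, .inr ?_⟩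
    rw [worm2, if_neg (by omega), if_neg (by omega), sub_add_cancel]
  by_cases c₂ : Y = y ∧ y = T ∧ X < x
  · refine ⟨(X, y, Z, Y, x - 1, T), by simp only [WormOK]; omega, .inr ?_⟩
    rw [worm2, if_neg (by omega), if_pos (by omega), sub_add_cancel]
  by_cases c₃ : 0 < Y
  · refine ⟨(X, y, Z, Y - 1, x, T), by simp only [WormOK]; omega, .inr ?_⟩
    rw [worm2, if_pos (by omega), sub_add_cancel]
  by_cases c₄ : 2 * x < X + Z
  · refine ⟨(X, y, Z - 2, Y, x, T), by simp only [WormOK]; omega, .inl ?_⟩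
    rw [worm1, if_neg (by omega), if_neg (by omega), sub_add_cancel]
  by_cases c₅ : 0 < y
  · refine ⟨(X, y - 1, Z, Y, x, T), by simp only [WormOK]; omega, .inl ?_⟩
    rw [worm1, if_neg (by omega), if_pos (by omega), sub_add_cancel]
  · refine ⟨(X - 2, y, Z, Y, x, T), by simp only [WormOK]; omega, .inl ?_⟩
    rw [worm1, if_pos (by omega), sub_add_cancel]

/-- The total length of a worm, which increases along all edges. -/
def wormSize : ℤ × ℤ × ℤ × ℤ × ℤ × ℤ → ℕ
  | (x', y, x'', y', x, y'') => (x' + y + x'' + y' + x + y'').toNat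

theorem wormSize_lt_worm1 (hw : WormOK g₁ g₂ w) : wormSize w < wormSize (worm1 w) := by
  obtain ⟨X, y, Z, Y, x, T⟩ := w
  simp only [worm1, wormSize, WormOK] at *
  split_ifs <;> simp only <;> omega

theorem wormSize_lt_worm2 (hw : WormOK g₁ g₂ w) : wormSize w < wormSize (worm2 w) := by
  obtain ⟨X, y, Z, Y, x, T⟩ := w
  simp only [worm2, wormSize, WormOK] at *
  split_ifs <;> simp only <;> omega

theorem wormOK_zero : WormOK g₁ g₂ (0, 0, 0, 0, 0, 0) := by
  simp [WormOK]

theorem Pattern.local_worm :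
    Local (fun i (u v : Pattern.Of (symTop g₁ g₂)) => Pattern.Arrow (symTop g₁ g₂) i u.1 v.1)
      (fun i u => Pattern.out (symTop g₁ g₂) i u.1) (fun i u => Pattern.inc (symTop g₁ g₂) i u.1)
      ⟨wormPattern g₁ g₂ (0, 0, 0, 0, 0, 0), wormPattern_valid wormOK_zero⟩ where
  fwd := Pattern.halfLocal _
  bwd := Pattern.halfLocal_flip _
  source i u a := by
    have h0 := Pattern.out_nonneg i (Pattern.dual_valid u.2)
    have h1 := (Pattern.arrow_step a).2
    rw [Pattern.out_dual] at h0
    simp [Pattern.inc, symTop, wormPattern] at h0 h1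
    grind

end Worm

theorem extractB_F_eq_some_iff {K : PreGraph} {σ : K.V → K.V} {i : ℕ}
    {u v : (extractB K 2 σ).V} :
    (extractB K 2 σ).F i u = some v ↔ chainB K 2 i u.1 = some v.1 := by
  obtain ⟨v, hv⟩ := v
  change (chainB K 2 i u.1).pbind (fun w _ => if hw : σ w = w then some ⟨w, hw⟩ else none) =
    some (⟨v, hv⟩ : {v // σ v = v}) ↔ chainB K 2 i u.1 = some v
  cases chainB K 2 i u.1 with
  | none => simp
  | some w =>
    simp only [Option.pbind_some, Option.some_inj]
    grind

theorem WormGraph_F_one {g₁ g₂ : ℕ} {u v : (WormGraph g₁ g₂).V} :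
    (WormGraph g₁ g₂).F 1 u = some v ↔ worm1 u.1 = v.1 := by
  obtain ⟨v, hv⟩ := v
  change (if h : WormOK g₁ g₂ (worm1 u.1) then some ⟨worm1 u.1, h⟩ else none) =
    some (⟨v, hv⟩ : {w // WormOK g₁ g₂ w}) ↔ worm1 u.1 = v
  grind

theorem WormGraph_F_two {g₁ g₂ : ℕ} {u v : (WormGraph g₁ g₂).V} :
    (WormGraph g₁ g₂).F 2 u = some v ↔ worm2 u.1 = v.1 := by
  obtain ⟨v, hv⟩ := v
  change (if h : WormOK g₁ g₂ (worm2 u.1) then some ⟨worm2 u.1, h⟩ else none) =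
    some (⟨v, hv⟩ : {w // WormOK g₁ g₂ w}) ↔ worm2 u.1 = v
  grind

section Symmetric
variable {K : PreGraph} {σ : K.V → K.V}

theorem fixed_of_F_two
    (hσ : ∀ (i : ℕ) (u v : K.V), K.F i u = some v ↔ K.F (4 - i) (σ u) = some (σ v))
    {u v : K.V} (hu : σ u = u) (e : K.F 2 u = some v) : σ v = v := by
  have := (hσ 2 u v).1 e
  rw [hu, e] at this
  exact (Option.some_inj.1 this).symm

theorem fixed_of_F_one_three (hK : IsACrystal 3 K)
    (hσ : ∀ (i : ℕ) (u v : K.V), K.F i u = some v ↔ K.F (4 - i) (σ u) = some (σ v))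
    {u x v : K.V} (hu : σ u = u) (e : K.F 1 u = some x) (e' : K.F 3 x = some v) : σ v = v := by
  have f := (hσ 1 u x).1 e
  have f' := (hσ 3 x v).1 e'
  rw [hu] at f
  obtain ⟨w, hw, hw'⟩ := (PreGraph.halfLocal hK).comm (i := 1) (j := 3) (.inl le_rfl) e f
  rw [e'] at hw
  exact Option.some_inj.1 (f'.symm.trans (hw'.trans hw.symm))

/-- A fixed vertex that is not a source has a fixed predecessor in the symmetric extract. -/
theorem exists_fixed_pred (hK : IsACrystal 3 K)
    (hσ : ∀ (i : ℕ) (u v : K.V), K.F i u = some v ↔ K.F (4 - i) (σ u) = some (σ v))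
    {i : ℕ} {u v : K.V} (hv : σ v = v) (e : K.F i u = some v) :
    ∃ w, σ w = w ∧ (K.F 2 w = some v ∨ ∃ x, K.F 1 w = some x ∧ K.F 3 x = some v) := by
  have inj := hK.1.2.2.1
  have f := (hσ i u v).1 e
  rw [hv] at f
  obtain ⟨h1, h3⟩ := PreGraph.color_mem hK.1 e
  interval_cases i
  · obtain ⟨w, hw, hw'⟩ := (PreGraph.halfLocal_flip hK).comm (i := 1) (j := 3) (.inl le_rfl) e f
    exact ⟨w, inj _ _ _ _ ((hσ 3 w u).1 hw) hw', .inr ⟨_, hw', f⟩⟩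
  · exact ⟨u, inj _ _ _ _ f e, .inl e⟩
  · obtain ⟨w, hw, hw'⟩ := (PreGraph.halfLocal_flip hK).comm (i := 1) (j := 3) (.inl le_rfl) f e
    exact ⟨w, inj _ _ _ _ ((hσ 1 w u).1 hw') hw, .inr ⟨_, hw', e⟩⟩

end Symmetric

/-- the symmetric extract of a symmetric `A_3`-crystal `K(c1, c2, c1)` is
isomorphic, as a 2-colored graph (`1bar ↦ 1tilde`, `2bar ↦ 2tilde`), to the worm graph
`W(c1, c2)`. -/
theorem A3_extract_iso_worm
    (K : PreGraph) (hK : IsACrystal 3 K)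
    (s : K.V) (hs : IsSource K s)
    (c : ℕ → ℕ) (hc : ∀ i, 1 ≤ i → i ≤ 3 → K.h i s = c i) (hsym : c 3 = c 1)
    (σ : K.V → K.V) (hσb : Function.Bijective σ)
    (hσ : ∀ (i : ℕ) (u v : K.V), K.F i u = some v ↔ K.F (4 - i) (σ u) = some (σ v)) :
    IsoVia (extractB K 2 σ) (WormGraph (c 1) (c 2)) (fun x => x) := by
  have A : Local (fun i u v => K.F i u = some v) (fun i u => (K.h i u : ℤ))
      (fun i u => (K.t i u : ℤ)) s := ⟨PreGraph.halfLocal hK, PreGraph.halfLocal_flip hK, hs⟩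
  obtain ⟨e, rk, inj, es, push, pull, hrk, src⟩ := A.exists_embedding
    (Pattern.local_worm (g₁ := c 1) (g₂ := c 2))
    (fun i h1 h3 => by
      rw [hc i h1 h3]
      interval_cases i <;> simp [Pattern.out, symTop, wormPattern, hsym]
      ring)
    (hK.2.1 s)
  have step2 : ∀ {u v w}, (e u).1 = wormPattern (c 1) (c 2) w → WormOK (c 1) (c 2) w →
      K.F 2 u = some v →
      WormOK (c 1) (c 2) (worm2 w) ∧ (e v).1 = wormPattern (c 1) (c 2) (worm2 w) := by
    intro u v w hu hw a
    have a' := (push 2 u v).1 a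
    rw [hu] at a'
    have ok := wormOK_worm2 hw a'
    exact ⟨ok, Pattern.arrow_det a' (arrow_worm2 hw ok)⟩
  have step1 : ∀ {u x v w}, (e u).1 = wormPattern (c 1) (c 2) w → WormOK (c 1) (c 2) w →
      K.F 1 u = some x → K.F 3 x = some v →
      WormOK (c 1) (c 2) (worm1 w) ∧ (e v).1 = wormPattern (c 1) (c 2) (worm1 w) := by
    intro u x v w hu hw a b
    have a' := (push 1 u x).1 a
    have b' := (push 3 x v).1 b
    rw [hu] at a'
    have ok := wormOK_worm1 hw a' b'
    obtain ⟨g, p, q⟩ := arrow_worm1 hw ok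
    obtain rfl := Pattern.arrow_det a' p
    exact ⟨ok, Pattern.arrow_det b' q⟩
  have back2 : ∀ {u w}, (e u).1 = wormPattern (c 1) (c 2) w → WormOK (c 1) (c 2) w →
      WormOK (c 1) (c 2) (worm2 w) →
      ∃ v, K.F 2 u = some v ∧ (e v).1 = wormPattern (c 1) (c 2) (worm2 w) := by
    intro u w hu hw ok
    obtain ⟨v, a, hv⟩ := pull 2 u ⟨_, wormPattern_valid ok⟩ (hu ▸ arrow_worm2 hw ok)
    exact ⟨v, a, congrArg Subtype.val hv⟩
  have back1 : ∀ {u w}, (e u).1 = wormPattern (c 1) (c 2) w → WormOK (c 1) (c 2) w →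
      WormOK (c 1) (c 2) (worm1 w) → ∃ x v, K.F 1 u = some x ∧ K.F 3 x = some v ∧
        (e v).1 = wormPattern (c 1) (c 2) (worm1 w) := by
    intro u w hu hw ok
    obtain ⟨g, p, q⟩ := arrow_worm1 hw ok
    rw [← hu] at p
    obtain ⟨x, a, hx⟩ := pull 1 u ⟨g, Pattern.arrow_valid (e u).2 p⟩ p
    obtain ⟨v, b, hv⟩ := pull 3 x ⟨_, wormPattern_valid ok⟩ (by rw [hx]; exact q)
    exact ⟨x, v, a, b, congrArg Subtype.val hv⟩
  have fixed_s : σ s = s := by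
    refine src _ fun i u a => ?_
    obtain ⟨u, rfl⟩ := hσb.2 u
    obtain ⟨h1, h3⟩ := PreGraph.color_mem hK.1 a
    refine hs (4 - i) u ((hσ (4 - i) u s).2 ?_)
    rwa [Nat.sub_sub_self (by omega)]
  have toWorm : ∀ u : (extractB K 2 σ).V, ∃ w : (WormGraph (c 1) (c 2)).V,
      (e u.1).1 = wormPattern (c 1) (c 2) w.1 := by
    rintro ⟨u, hu⟩
    induction hn : rk u using Nat.strong_induction_on generalizing u with
    | _ n ih =>
      by_cases hus : u = s
      · subst hus
        exact ⟨⟨_, wormOK_zero⟩, by rw [es]⟩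
      have : ∃ i v, K.F i v = some u := by
        by_contra hno
        push Not at hno
        exact hus (src u hno)
      obtain ⟨i, v, a⟩ := this
      obtain ⟨w, hw, a | ⟨x, a, b⟩⟩ := exists_fixed_pred hK hσ hu a
      · obtain ⟨z, hz⟩ := ih _ (by have := hrk _ _ _ a; omega) w hw rfl
        obtain ⟨ok, hok⟩ := step2 hz z.2 a
        exact ⟨⟨_, ok⟩, hok⟩
      · obtain ⟨z, hz⟩ := ih _ (by have := hrk _ _ _ a; have := hrk _ _ _ b; omega) w hw rfl
        obtain ⟨ok, hok⟩ := step1 hz z.2 a b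
        exact ⟨⟨_, ok⟩, hok⟩
  have ofWorm : ∀ w, WormOK (c 1) (c 2) w →
      ∃ u, σ u = u ∧ (e u).1 = wormPattern (c 1) (c 2) w := by
    intro w hw
    induction hn : wormSize w using Nat.strong_induction_on generalizing w with
    | _ n ih =>
      by_cases h0 : w = (0, 0, 0, 0, 0, 0)
      · exact ⟨s, fixed_s, by rw [es, h0]⟩
      obtain ⟨w', hw', rfl | rfl⟩ := exists_worm_pred hw h0
      · obtain ⟨u, hu, hu'⟩ := ih _ (hn ▸ wormSize_lt_worm1 hw') w' hw' rfl
        obtain ⟨x, v, a, b, hv⟩ := back1 hu' hw' hw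
        exact ⟨v, fixed_of_F_one_three hK hσ hu a b, hv⟩
      · obtain ⟨u, hu, hu'⟩ := ih _ (hn ▸ wormSize_lt_worm2 hw') w' hw' rfl
        obtain ⟨v, a, hv⟩ := back2 hu' hw' hw
        exact ⟨v, fixed_of_F_two hσ hu a, hv⟩
  choose f hf using toWorm
  have bij : Function.Bijective f := by
    refine ⟨fun u v huv => ?_, fun w => ?_⟩
    · exact Subtype.ext (inj (Subtype.ext (by rw [hf, hf, huv])))
    · obtain ⟨u, hu, hu'⟩ := ofWorm w.1 w.2
      refine ⟨⟨u, hu⟩, Subtype.ext (wormPattern_injective (f _).2 w.2 ?_)⟩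
      exact (hf ⟨u, hu⟩).symm.trans hu'
  refine ⟨Equiv.ofBijective f bij, fun i u v => ?_⟩
  rw [extractB_F_eq_some_iff, Equiv.ofBijective_apply, Equiv.ofBijective_apply]
  by_cases hi : i = 1
  · subst hi
    rw [WormGraph_F_one]
    simp only [chainB, le_refl, Nat.one_le_ofNat, and_self, if_true, OfNat.one_ne_ofNat, if_false,
      Option.bind_eq_some_iff]
    constructor
    · rintro ⟨x, a, b⟩
      obtain ⟨ok, hv⟩ := step1 (hf u) (f u).2 a b
      exact wormPattern_injective ok (f v).2 (hv.symm.trans (hf v))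
    · intro hv
      obtain ⟨x, v', a, b, hv'⟩ := back1 (hf u) (f u).2 (hv ▸ (f v).2)
      rw [hv, ← hf] at hv'
      rw [← inj (Subtype.ext hv')]
      exact ⟨x, a, b⟩
  by_cases hi' : i = 2
  · subst hi'
    rw [WormGraph_F_two]
    simp only [chainB, le_refl, Nat.one_le_ofNat, and_self, if_true]
    constructor
    · intro a
      obtain ⟨ok, hv⟩ := step2 (hf u) (f u).2 a
      exact wormPattern_injective ok (f v).2 (hv.symm.trans (hf v))
    · intro hv
      obtain ⟨v', a, hv'⟩ := back2 (hf u) (f u).2 (hv ▸ (f v).2)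
      rw [hv, ← hf] at hv'
      rwa [← inj (Subtype.ext hv')]
  · have hi'' : ¬ (1 ≤ i ∧ i ≤ 2) := by omega
    simp [chainB, WormGraph, hi, hi', hi'']
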